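/- Let S = {s₀=(0,0), s₁=(1,−1), s₂=(2,0), s₃=(1,1)} ⊆ ℤ² with the 8-adjacency (k(2,2)-adjacency), and identify S × S with a subset of ℤ⁴. Then for t ∈ {1,2,3,4}, the k(t,4)-adjacency on S × S is a C-compatible k-adjacency derived from (S,8) and (S,8) if and only if t ∈ {2,3}; in particular, the minimal C-compatible adjacency is C_{k*} with k* = k(2,4) = 32. -/

import Mathlib

/-- `k(t,·)`-adjacency of points of `ℤ^ι`. -/
def kAdj {ι : Type*} [Fintype ι] (t : ℕ) (p q : ι → ℤ) : Prop :=
  p ≠ q ∧ (∀ i, |p i - q i| ≤ 1) ∧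
    (Finset.univ.filter (fun i => p i ≠ q i)).card ≤ t

/-- The `k(t,n₁+n₂)`-adjacency is a *C-compatible* `k`-adjacency on `X × Y`. -/
def IsCCompatibleAdj {n₁ n₂ : ℕ} (X : Set (Fin n₁ → ℤ)) (Y : Set (Fin n₂ → ℤ))
    (t₁ t₂ t : ℕ) : Prop :=
  ∀ x ∈ X, ∀ y ∈ Y, ∀ x' ∈ X, ∀ y' ∈ Y,
    (kAdj t (Fin.append x y) (Fin.append x' y') ↔
      ((y = y' ∧ kAdj t₁ x x') ∨ (x = x' ∧ kAdj t₂ y y')))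

/-- `SC₈^{2,4} = {(0,0),(1,-1),(2,0),(1,1)} ⊆ ℤ²`. -/
def SC84 : Set (Fin 2 → ℤ) := {![0, 0], ![1, -1], ![2, 0], ![1, 1]}

theorem kAdj_iff_hammingDist {ι : Type*} [Fintype ι] {t : ℕ} {p q : ι → ℤ} :
    kAdj t p q ↔ p ≠ q ∧ (∀ i, |p i - q i| ≤ 1) ∧ hammingDist p q ≤ t :=
  Iff.rfl

theorem hammingDist_fin_append {m n : ℕ} {α : Type*} [DecidableEq α]
    (x x' : Fin m → α) (y y' : Fin n → α) :
    hammingDist (Fin.append x y) (Fin.append x' y') = hammingDist x x' + hammingDist y y' := by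
  simp only [hammingDist, Finset.card_filter, Fin.sum_univ_add, Fin.append_left, Fin.append_right]

theorem kAdj_append_iff {m n t : ℕ} {x x' : Fin m → ℤ} {y y' : Fin n → ℤ} :
    kAdj t (Fin.append x y) (Fin.append x' y') ↔
      (x ≠ x' ∨ y ≠ y') ∧ ((∀ i, |x i - x' i| ≤ 1) ∧ ∀ i, |y i - y' i| ≤ 1) ∧
        hammingDist x x' + hammingDist y y' ≤ t := by
  rw [kAdj_iff_hammingDist, hammingDist_fin_append, ← hammingDist_ne_zero,
    hammingDist_fin_append, ← hammingDist_ne_zero, ← hammingDist_ne_zero, Fin.forall_fin_add]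
  simp only [Fin.append_left, Fin.append_right]
  refine and_congr_left fun _ => ?_
  omega

/-- Distinct points of `SC84` within sup-distance one differ in both coordinates. -/
theorem hammingDist_eq_two_of_mem_SC84 {x x' : Fin 2 → ℤ} (hx : x ∈ SC84) (hx' : x' ∈ SC84)
    (hne : x ≠ x') (h : ∀ i, |x i - x' i| ≤ 1) : hammingDist x x' = 2 := by
  simp only [SC84, Set.mem_insert_iff, Set.mem_singleton_iff] at hx hx'
  rcases hx with rfl | rfl | rfl | rfl <;> rcases hx' with rfl | rfl | rfl | rfl <;>
    revert hne h <;> decide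

theorem isCCompatibleAdj_SC84_iff {t : ℕ} :
    IsCCompatibleAdj SC84 SC84 2 2 t ↔ t = 2 ∨ t = 3 := by
  have h₀ : ![0, 0] ∈ SC84 := by simp [SC84]
  have h₁ : ![1, -1] ∈ SC84 := by simp [SC84]
  have hadj : kAdj 2 (![0, 0] : Fin 2 → ℤ) ![1, -1] := by
    rw [kAdj_iff_hammingDist]; decide
  have hdist : hammingDist (![0, 0] : Fin 2 → ℤ) ![1, -1] = 2 := by decide
  constructor
  · intro h
    have hlower := (kAdj_append_iff.1 ((h _ h₀ _ h₀ _ h₁ _ h₀).2 (Or.inl ⟨rfl, hadj⟩))).2.2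
    rw [hdist, hammingDist_self] at hlower
    by_contra ht
    have hupper := (h _ h₀ _ h₀ _ h₁ _ h₁).1 (kAdj_append_iff.2
      ⟨Or.inl hadj.1, ⟨hadj.2.1, hadj.2.1⟩, by rw [hdist]; omega⟩)
    exact hupper.elim (fun h' => hadj.1 h'.1) fun h' => hadj.1 h'.1
  · intro ht x hx y hy x' hx' y' hy'
    rw [kAdj_append_iff, kAdj_iff_hammingDist, kAdj_iff_hammingDist]
    have hdx := hammingDist_eq_two_of_mem_SC84 hx hx'
    have hdy := hammingDist_eq_two_of_mem_SC84 hy hy'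
    by_cases hxx : x = x' <;> by_cases hyy : y = y'
    · simp [hxx, hyy]
    · subst hxx
      simp only [ne_eq, hyy, not_false_eq_true, not_true_eq_false, hammingDist_self, sub_self,
        abs_zero, zero_le_one, implies_true, true_and, false_and, false_or, zero_add]
      exact and_congr_right fun h => by rw [hdy hyy h]; omega
    · subst hyy
      simp only [ne_eq, hxx, not_false_eq_true, not_true_eq_false, hammingDist_self, sub_self,
        abs_zero, zero_le_one, implies_true, true_and, and_true, false_and, or_false, add_zero]
      exact and_congr_right fun h => by rw [hdx hxx h]; omega
    · simp only [hxx, hyy, false_and, or_self, iff_false]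
      rintro ⟨-, ⟨h, h'⟩, hle⟩
      rw [hdx hxx h, hdy hyy h'] at hle
      omega

/-- For `t ∈ {1,2,3,4}`, the `k(t,4)`-adjacency on `SC₈^{2,4} × SC₈^{2,4} ⊆ ℤ⁴` is a
C-compatible `k`-adjacency derived from `(SC₈^{2,4},8)` and `(SC₈^{2,4},8)` iff
`t ∈ {2,3}`; in particular the minimal C-compatible adjacency is `k* = k(2,4) = 32`. -/
theorem sc84_prod_cCompatible_iff :
    (∀ t : ℕ, 1 ≤ t → t ≤ 4 →
      (IsCCompatibleAdj SC84 SC84 2 2 t ↔ (t = 2 ∨ t = 3))) ∧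
      IsLeast {t : ℕ | IsCCompatibleAdj SC84 SC84 2 2 t} 2 := by
  refine ⟨fun _ _ _ => isCCompatibleAdj_SC84_iff,
    isCCompatibleAdj_SC84_iff.2 (Or.inl rfl), fun t ht => ?_⟩
  have := isCCompatibleAdj_SC84_iff.1 ht
  omega
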